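/- arXiv:1011.2305 — 2 statements merged into one kernel-verified Lean document; each statement's English description precedes it below -/
import Mathlib

section
/- Let a > 0 be real, and let B⁺ and B⁻ be the ℂ-linear operators on the space of finitely supported functions ℕ → ℂ defined on the standard basis (e_k)_{k≥0} by B⁺e_{2n} = √(2(n+a))·e_{2n+1}, B⁺e_{2n+1} = √(2(n+1))·e_{2n+2}, B⁻e_{2n} = √(2n)·e_{2n−1} (so B⁻e_0 = 0), and B⁻e_{2n+1} = √(2(n+a))·e_{2n}. Define the position and momentum operators X = (B⁺ + B⁻)/√2 and P = i(B⁺ − B⁻)/√2. Then for every n ≥ 0: [X,P]·e_{2n} = 2ai·e_{2n} and [X,P]·e_{2n+1} = 2(1−a)i·e_{2n+1}. In particular, the canonical commutation relation [X,P] = i·Id holds exactly when a = 1/2. -/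
/-- The commutator of position and momentum is `i` times the commutator of `B⁻` and `B⁺`. -/
theorem position_momentum_commutator_eq {M : Type*} [AddCommGroup M] [Module ℂ M]
    (Bp Bm : M →ₗ[ℂ] M) :
    ((Real.sqrt 2 : ℂ)⁻¹ • (Bp + Bm)) ∘ₗ ((Complex.I / (Real.sqrt 2 : ℂ)) • (Bp - Bm))
        - ((Complex.I / (Real.sqrt 2 : ℂ)) • (Bp - Bm)) ∘ₗ ((Real.sqrt 2 : ℂ)⁻¹ • (Bp + Bm))
      = Complex.I • (Bm ∘ₗ Bp - Bp ∘ₗ Bm) := by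
  have h : (Real.sqrt 2 : ℂ)⁻¹ * (Complex.I / (Real.sqrt 2 : ℂ)) = Complex.I / 2 := by
    rw [inv_mul_eq_div, div_div, ← Complex.ofReal_mul, Real.mul_self_sqrt zero_le_two,
      Complex.ofReal_ofNat]
  simp only [LinearMap.smul_comp, LinearMap.comp_smul, LinearMap.add_comp, LinearMap.comp_add,
    LinearMap.sub_comp, LinearMap.comp_sub]
  match_scalars
  · ring
  · linear_combination 2 * h
  · linear_combination (-2) * h
  · ring

theorem ofReal_sqrt_mul_self {x : ℝ} (hx : 0 ≤ x) :
    (Real.sqrt x : ℂ) * (Real.sqrt x : ℂ) = (x : ℂ) := by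
  rw [← Complex.ofReal_mul, Real.mul_self_sqrt hx]


/-- with `X = (B⁺ + B⁻)/√2` and `P = i(B⁺ − B⁻)/√2` built from the
positive discrete series operators with parameter `a > 0`, one has
`[X,P] e_{2n} = 2ai·e_{2n}` and `[X,P] e_{2n+1} = 2(1−a)i·e_{2n+1}`, and the
canonical commutation relation `[X,P] = i·Id` holds exactly when `a = 1/2`. -/
theorem osp12_position_momentum_commutator (a : ℝ) (ha : 0 < a)
    (Bp Bm X P : (ℕ →₀ ℂ) →ₗ[ℂ] (ℕ →₀ ℂ))
    (hp0 : ∀ n : ℕ, Bp (Finsupp.single (2 * n) 1)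
        = (Real.sqrt (2 * ((n : ℝ) + a)) : ℂ) • Finsupp.single (2 * n + 1) 1)
    (hp1 : ∀ n : ℕ, Bp (Finsupp.single (2 * n + 1) 1)
        = (Real.sqrt (2 * ((n : ℝ) + 1)) : ℂ) • Finsupp.single (2 * n + 2) 1)
    (hm0 : Bm (Finsupp.single 0 1) = 0)
    (hm1 : ∀ n : ℕ, Bm (Finsupp.single (2 * (n + 1)) 1)
        = (Real.sqrt (2 * ((n : ℝ) + 1)) : ℂ) • Finsupp.single (2 * n + 1) 1)
    (hm2 : ∀ n : ℕ, Bm (Finsupp.single (2 * n + 1) 1)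
        = (Real.sqrt (2 * ((n : ℝ) + a)) : ℂ) • Finsupp.single (2 * n) 1)
    (hX : X = (Real.sqrt 2 : ℂ)⁻¹ • (Bp + Bm))
    (hP : P = (Complex.I / (Real.sqrt 2 : ℂ)) • (Bp - Bm)) :
    (∀ n : ℕ, (X ∘ₗ P - P ∘ₗ X) (Finsupp.single (2 * n) 1)
        = (2 * (a : ℂ) * Complex.I) • Finsupp.single (2 * n) 1) ∧
    (∀ n : ℕ, (X ∘ₗ P - P ∘ₗ X) (Finsupp.single (2 * n + 1) 1)
        = (2 * (1 - (a : ℂ)) * Complex.I) • Finsupp.single (2 * n + 1) 1) ∧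
    (X ∘ₗ P - P ∘ₗ X
        = Complex.I • (LinearMap.id : (ℕ →₀ ℂ) →ₗ[ℂ] (ℕ →₀ ℂ)) ↔ a = 1 / 2) := by
  subst hX hP
  rw [position_momentum_commutator_eq]
  have sqrt_add_sq (n : ℕ) := ofReal_sqrt_mul_self (x := 2 * ((n : ℝ) + a)) (by positivity)
  have sqrt_succ_sq (n : ℕ) := ofReal_sqrt_mul_self (x := 2 * ((n : ℝ) + 1)) (by positivity)
  have even_eq (n : ℕ) : (Complex.I • (Bm ∘ₗ Bp - Bp ∘ₗ Bm)) (Finsupp.single (2 * n) 1)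
      = (2 * (a : ℂ) * Complex.I) • Finsupp.single (2 * n) 1 := by
    have hpm : Bp (Bm (Finsupp.single (2 * n) 1))
        = (2 * (n : ℂ)) • Finsupp.single (2 * n) 1 := by
      cases n with
      | zero => simp [hm0]
      | succ m =>
        rw [hm1, map_smul, hp1, smul_smul, sqrt_succ_sq]
        push_cast
        rfl
    rw [LinearMap.smul_apply, LinearMap.sub_apply, LinearMap.comp_apply, LinearMap.comp_apply,
      hpm, hp0, map_smul, hm2, smul_smul, sqrt_add_sq]
    push_cast
    module
  have odd_eq (n : ℕ) : (Complex.I • (Bm ∘ₗ Bp - Bp ∘ₗ Bm)) (Finsupp.single (2 * n + 1) 1)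
      = (2 * (1 - (a : ℂ)) * Complex.I) • Finsupp.single (2 * n + 1) 1 := by
    have hmp : Bm (Finsupp.single (2 * n + 2) 1)
        = (Real.sqrt (2 * ((n : ℝ) + 1)) : ℂ) • Finsupp.single (2 * n + 1) 1 := hm1 n
    rw [LinearMap.smul_apply, LinearMap.sub_apply, LinearMap.comp_apply, LinearMap.comp_apply,
      hp1, map_smul, hmp, hm2, map_smul, hp0, smul_smul, smul_smul, sqrt_add_sq, sqrt_succ_sq]
    push_cast
    module
  refine ⟨even_eq, odd_eq, fun h => ?_, fun h => ?_⟩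
  · have h0 := even_eq 0
    rw [h] at h0
    have h1 : Complex.I = 2 * (a : ℂ) * Complex.I := by
      simpa using DFunLike.congr_fun h0 0
    have h2 : (1 : ℝ) = 2 * a := by simpa using congrArg Complex.im h1
    linarith
  · subst h
    refine Finsupp.lhom_ext' fun k => LinearMap.ext_ring ?_
    change (Complex.I • (Bm ∘ₗ Bp - Bp ∘ₗ Bm)) (Finsupp.single k 1)
      = Complex.I • Finsupp.single k 1
    obtain ⟨n, rfl | rfl⟩ := k.even_or_odd'
    · rw [even_eq]
      push_cast
      module
    · rw [odd_eq]
      push_cast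
      module
end

section
/- Let a > 0 and p ∈ ℝ. The coefficients γ_n(p) = iⁿ·β_n(p) of the formal eigenvector of the momentum operator p̂ satisfy, for all n ≥ 0 (with the convention γ_{−1} = 0), the coupled pair of recurrence relations p·γ_{2n}(p) = i√n·γ_{2n−1}(p) − i√(n+a)·γ_{2n+1}(p) and p·γ_{2n+1}(p) = i√(n+a)·γ_{2n}(p) − i√(n+1)·γ_{2n+2}(p). -/
/-- Pochhammer symbol `(c)_k` in `ℂ`. -/
noncomputable def pochC (c : ℂ) (k : ℕ) : ℂ := ∏ j ∈ Finset.range k, (c + j)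

/-- Pochhammer symbol `(c)_k` in `ℝ`. -/
noncomputable def pochR (c : ℝ) (k : ℕ) : ℝ := ∏ j ∈ Finset.range k, (c + j)

/-- The prefactor `ℬ₀(x) = |x|^{a−1/2}·e^{−x²/2}/√Γ(a)`. -/
noncomputable def calB0 (a x : ℝ) : ℝ :=
  |x| ^ (a - 1 / 2) * Real.exp (-x ^ 2 / 2) / Real.sqrt (Real.Gamma a)

/-- The prefactor `ℬ₁(x) = x·|x|^{a−1/2}·e^{−x²/2}/√Γ(a+1)`. -/
noncomputable def calB1 (a x : ℝ) : ℝ :=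
  x * |x| ^ (a - 1 / 2) * Real.exp (-x ^ 2 / 2) / Real.sqrt (Real.Gamma (a + 1))

/-- The coefficient `β_{2n}(x) = (−1)ⁿ √((a)_n/n!) ℬ₀(x) ₁F₁(−n; a; x²)`,
a normalized generalized Hermite function. -/
noncomputable def betaEv (a x : ℝ) (n : ℕ) : ℂ :=
  (-1) ^ n * (Real.sqrt (pochR a n / n.factorial) : ℂ) * (calB0 a x : ℂ) *
    ∑ k ∈ Finset.range (n + 1),
      pochC (-(n : ℂ)) k / (pochC (a : ℂ) k * (k.factorial : ℂ)) * (x : ℂ) ^ (2 * k)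

/-- The coefficient `β_{2n+1}(x) = (−1)ⁿ √((a+1)_n/n!) ℬ₁(x) ₁F₁(−n; a+1; x²)`,
a normalized generalized Hermite function. -/
noncomputable def betaOdd (a x : ℝ) (n : ℕ) : ℂ :=
  (-1) ^ n * (Real.sqrt (pochR (a + 1) n / n.factorial) : ℂ) * (calB1 a x : ℂ) *
    ∑ k ∈ Finset.range (n + 1),
      pochC (-(n : ℂ)) k / (pochC ((a : ℂ) + 1) k * (k.factorial : ℂ)) * (x : ℂ) ^ (2 * k)

/-- The full family `β_m(x)`, combining even and odd indices. -/
noncomputable def betaFn (a x : ℝ) (m : ℕ) : ℂ :=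
  if Even m then betaEv a x (m / 2) else betaOdd a x (m / 2)

open Finset in
theorem pochC_succ_right (c : ℂ) (k : ℕ) : pochC c (k + 1) = pochC c k * (c + k) :=
  prod_range_succ _ _

open Finset in
theorem pochC_succ_left (c : ℂ) (k : ℕ) : pochC c (k + 1) = c * pochC (c + 1) k := by
  simp only [pochC, prod_range_succ']
  rw [mul_comm]
  congr 1
  · simp
  · exact prod_congr rfl fun j _ => by push_cast; ring

open Finset in
theorem pochR_succ_right (c : ℝ) (k : ℕ) : pochR c (k + 1) = pochR c k * (c + k) :=
  prod_range_succ _ _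

open Finset in
theorem pochR_succ_left (c : ℝ) (k : ℕ) : pochR c (k + 1) = c * pochR (c + 1) k := by
  simp only [pochR, prod_range_succ']
  rw [mul_comm]
  congr 1
  · simp
  · exact prod_congr rfl fun j _ => by push_cast; ring

theorem pochR_pos {c : ℝ} (hc : 0 < c) (k : ℕ) : 0 < pochR c k :=
  Finset.prod_pos fun j _ => by positivity

theorem pochC_ofReal_ne_zero {c : ℝ} (hc : 0 < c) (k : ℕ) : pochC (c : ℂ) k ≠ 0 :=
  Finset.prod_ne_zero_iff.2 fun j _ => by
    have : c + j ≠ 0 := by positivity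
    exact_mod_cast this

theorem pochC_neg_natCast_succ_self (n : ℕ) : pochC (-(n : ℂ)) (n + 1) = 0 := by
  rw [pochC_succ_right]; simp

/-- The terminating hypergeometric sum `₁F₁(−n; c; x²)`. -/
noncomputable def kummerSum (c : ℂ) (n : ℕ) (x : ℂ) : ℂ :=
  ∑ k ∈ Finset.range (n + 1),
    pochC (-(n : ℂ)) k / (pochC c k * (k.factorial : ℂ)) * x ^ (2 * k)

theorem kummerSum_eq_sum_range_add_two (c : ℂ) (n : ℕ) (x : ℂ) :
    kummerSum c n x = ∑ k ∈ Finset.range (n + 1 + 1),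
      pochC (-(n : ℂ)) k / (pochC c k * (k.factorial : ℂ)) * x ^ (2 * k) := by
  rw [Finset.sum_range_succ, pochC_neg_natCast_succ_self]
  simp [kummerSum]

theorem kummerSum_zero (c x : ℂ) : kummerSum c 0 x = 1 := by
  simp [kummerSum, pochC]

/-- Contiguous relation raising the lower parameter. -/
theorem mul_kummerSum_succ {a : ℝ} (ha : 0 < a) (n : ℕ) (x : ℂ) :
    (a : ℂ) * kummerSum a (n + 1) x =
      (n + 1 + a) * kummerSum (a + 1) (n + 1) x - (n + 1) * kummerSum (a + 1) n x := by
  rw [kummerSum_eq_sum_range_add_two (a + 1) n, kummerSum, kummerSum, Finset.mul_sum,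
    Finset.mul_sum, Finset.mul_sum, ← Finset.sum_sub_distrib]
  refine Finset.sum_congr rfl fun k _ => ?_
  have h1 : pochC (a : ℂ) k ≠ 0 := pochC_ofReal_ne_zero ha k
  have h2 : pochC ((a : ℂ) + 1) k ≠ 0 := by
    exact_mod_cast pochC_ofReal_ne_zero (by linarith : 0 < a + 1) k
  have h3 : (k.factorial : ℂ) ≠ 0 := by exact_mod_cast k.factorial_ne_zero
  have e1 : (a : ℂ) * pochC (a + 1) k = pochC a k * (a + k) := by
    rw [← pochC_succ_left, pochC_succ_right]
  have e2 : (-(n + 1 : ℂ)) * pochC (-(n : ℂ)) k =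
      pochC (-(n + 1 : ℂ)) k * (-(n + 1 : ℂ) + k) := by
    rw [← pochC_succ_right, pochC_succ_left]
    congr 2
    ring
  push_cast
  field_simp
  linear_combination x ^ (2 * k) * (pochC (-(n + 1 : ℂ)) k * e1 - pochC (a : ℂ) k * e2)

/-- Contiguous relation lowering the degree. -/
theorem sq_mul_kummerSum {a : ℝ} (ha : 0 < a) (n : ℕ) (x : ℂ) :
    x ^ 2 * kummerSum (a + 1) n x = a * (kummerSum a n x - kummerSum a (n + 1) x) := by
  rw [kummerSum_eq_sum_range_add_two a n, kummerSum, kummerSum, ← Finset.sum_sub_distrib,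
    Finset.sum_range_succ' _ (n + 1), Finset.mul_sum]
  have h0 : ∀ c : ℂ, pochC c 0 = 1 := fun c => by simp [pochC]
  simp only [h0, sub_self, add_zero]
  rw [Finset.mul_sum]
  refine Finset.sum_congr rfl fun k _ => ?_
  have h0 : (a : ℂ) ≠ 0 := by exact_mod_cast ha.ne'
  have h2 : pochC ((a : ℂ) + 1) k ≠ 0 := by
    exact_mod_cast pochC_ofReal_ne_zero (by linarith : 0 < a + 1) k
  have h3 : (k.factorial : ℂ) ≠ 0 := by exact_mod_cast k.factorial_ne_zero
  have h4 : (k + 1 : ℂ) ≠ 0 := by exact_mod_cast k.succ_ne_zero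
  have e2 : pochC (-((n + 1 : ℕ) : ℂ)) (k + 1) = -(n + 1 : ℂ) * pochC (-(n : ℂ)) k := by
    rw [pochC_succ_left]
    push_cast
    congr 2
    ring
  rw [e2, pochC_succ_left (a : ℂ), pochC_succ_right (-(n : ℂ)), Nat.factorial_succ]
  push_cast
  field_simp
  ring

theorem calB1_eq {a : ℝ} (ha : 0 < a) (x : ℝ) : calB1 a x = x * calB0 a x / √a := by
  rw [calB1, calB0, Real.Gamma_add_one ha.ne', Real.sqrt_mul ha.le]
  ring

theorem sqrt_pochR_mul_calB1 {a : ℝ} (ha : 0 < a) (x : ℝ) (n : ℕ) :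
    a * (√(pochR (a + 1) n / n.factorial) * calB1 a x) =
      x * calB0 a x * √(pochR a n / n.factorial) * √(n + a) := by
  have hp : pochR (a + 1) n / n.factorial = pochR a n / n.factorial * (n + a) / a := by
    have : a * pochR (a + 1) n = pochR a n * (a + n) := by
      rw [← pochR_succ_left, pochR_succ_right]
    field_simp
    linear_combination this
  have hq := (pochR_pos ha n).le
  rw [hp, calB1_eq ha, Real.sqrt_div (by positivity), Real.sqrt_mul (by positivity)]
  have hs : √a ≠ 0 := by positivity
  field_simp
  rw [Real.sq_sqrt ha.le]
  ring

theorem sqrt_mul_sqrt_pochR_succ {a : ℝ} (ha : 0 < a) (n : ℕ) :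
    √((n : ℝ) + 1) * √(pochR a (n + 1) / (n + 1).factorial) =
      √(n + a) * √(pochR a n / n.factorial) := by
  rw [← Real.sqrt_mul (by positivity), ← Real.sqrt_mul (by positivity), pochR_succ_right,
    Nat.factorial_succ]
  congr 1
  push_cast
  field_simp
  ring

theorem betaEv_eq (a x : ℝ) (n : ℕ) : betaEv a x n =
    (-1) ^ n * (√(pochR a n / n.factorial) : ℂ) * (calB0 a x : ℂ) * kummerSum a n x := rfl

theorem mul_betaOdd {a : ℝ} (ha : 0 < a) (x : ℝ) (n : ℕ) : (a : ℂ) * betaOdd a x n =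
    (-1) ^ n * (x * calB0 a x * √(pochR a n / n.factorial) * √(n + a) : ℂ) *
      kummerSum (a + 1) n x := by
  have h : (a : ℂ) * ((√(pochR (a + 1) n / n.factorial) : ℂ) * (calB1 a x : ℂ)) =
      x * calB0 a x * √(pochR a n / n.factorial) * √(n + a) := by
    exact_mod_cast sqrt_pochR_mul_calB1 ha x n
  have hb : betaOdd a x n = (-1) ^ n * (√(pochR (a + 1) n / n.factorial) : ℂ) *
      (calB1 a x : ℂ) * kummerSum (a + 1) n x := rfl
  rw [hb]
  linear_combination (-1) ^ n * kummerSum (a + 1) n x * h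

theorem ofReal_sqrt_mul_self_s9 {y : ℝ} (hy : 0 ≤ y) : (√y : ℂ) * √y = y := by
  exact_mod_cast Real.mul_self_sqrt hy

theorem mul_betaEv_zero {a : ℝ} (ha : 0 < a) (x : ℝ) :
    (x : ℂ) * betaEv a x 0 = √a * betaOdd a x 0 := by
  have h0 : (a : ℂ) ≠ 0 := by exact_mod_cast ha.ne'
  have hO := mul_betaOdd ha x 0
  have hs := ofReal_sqrt_mul_self_s9 ha.le
  apply mul_left_cancel₀ h0
  rw [betaEv_eq]
  simp only [kummerSum_zero, Nat.cast_zero, zero_add] at hO ⊢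
  linear_combination -(√a : ℂ) * hO -
    (x * calB0 a x * √(pochR a 0 / (Nat.factorial 0)) : ℂ) * hs

theorem mul_betaEv_succ {a : ℝ} (ha : 0 < a) (x : ℝ) (n : ℕ) :
    (x : ℂ) * betaEv a x (n + 1) =
      √((n : ℝ) + 1) * betaOdd a x n + √((n : ℝ) + 1 + a) * betaOdd a x (n + 1) := by
  have h0 : (a : ℂ) ≠ 0 := by exact_mod_cast ha.ne'
  have hO := mul_betaOdd ha x n
  have hO' := mul_betaOdd ha x (n + 1)
  have hs := ofReal_sqrt_mul_self_s9 (by positivity : 0 ≤ (n : ℝ) + 1)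
  have hs' := ofReal_sqrt_mul_self_s9 (by positivity : 0 ≤ (n : ℝ) + 1 + a)
  have hr : (√((n : ℝ) + 1) : ℂ) * √(pochR a (n + 1) / (n + 1).factorial) =
      √(n + a) * √(pochR a n / n.factorial) := by
    exact_mod_cast sqrt_mul_sqrt_pochR_succ ha n
  have hk := mul_kummerSum_succ ha n x
  apply mul_left_cancel₀ h0
  rw [betaEv_eq]
  push_cast at hO hO' hs hs' hr ⊢
  generalize (√(pochR a (n + 1) / (n + 1).factorial) : ℂ) = r' at *
  generalize (√(pochR a n / n.factorial) : ℂ) = r at *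
  generalize (√((n : ℝ) + 1) : ℂ) = s at *
  generalize (√((n : ℝ) + 1 + a) : ℂ) = s' at *
  generalize (√((n : ℝ) + a) : ℂ) = t at *
  rw [pow_succ] at *
  linear_combination -s * hO - s' * hO' - (-1) ^ n * x * calB0 a x * r' * hk +
    (-1) ^ n * x * calB0 a x * kummerSum (a + 1) n x * (s * hr - r' * hs) +
    (-1) ^ n * x * calB0 a x * kummerSum (a + 1) (n + 1) x * r' * hs'

theorem mul_betaOdd_eq {a : ℝ} (ha : 0 < a) (x : ℝ) (n : ℕ) :
    (x : ℂ) * betaOdd a x n =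
      √((n : ℝ) + a) * betaEv a x n + √((n : ℝ) + 1) * betaEv a x (n + 1) := by
  have h0 : (a : ℂ) ≠ 0 := by exact_mod_cast ha.ne'
  have hO := mul_betaOdd ha x n
  have hr : (√((n : ℝ) + 1) : ℂ) * √(pochR a (n + 1) / (n + 1).factorial) =
      √(n + a) * √(pochR a n / n.factorial) := by
    exact_mod_cast sqrt_mul_sqrt_pochR_succ ha n
  have hk := sq_mul_kummerSum ha n x
  apply mul_left_cancel₀ h0
  rw [betaEv_eq, betaEv_eq, pow_succ]
  linear_combination x * hO +
    (-1) ^ n * calB0 a x * √(pochR a n / n.factorial) * √(n + a) * hk +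
    a * (-1) ^ n * calB0 a x * kummerSum a (n + 1) x * hr

theorem betaFn_two_mul (a x : ℝ) (n : ℕ) : betaFn a x (2 * n) = betaEv a x n := by
  simp [betaFn]

theorem betaFn_two_mul_add_one (a x : ℝ) (n : ℕ) :
    betaFn a x (2 * n + 1) = betaOdd a x n := by
  have h : (2 * n + 1) / 2 = n := by omega
  simp [betaFn, h]

/-- the coefficients `γ_n(p) = iⁿ·β_n(p)` of the formal eigenvector of
the momentum operator `p̂` satisfy, with the convention `γ_{−1} = 0`, the coupled
recurrences `p·γ_{2n} = i√n·γ_{2n−1} − i√(n+a)·γ_{2n+1}` and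
`p·γ_{2n+1} = i√(n+a)·γ_{2n} − i√(n+1)·γ_{2n+2}`. -/
theorem gammaFn_recurrence (a p : ℝ) (ha : 0 < a) (γ : ℕ → ℂ)
    (hγ : ∀ m : ℕ, γ m = Complex.I ^ m * betaFn a p m) (n : ℕ) :
    ((p : ℂ) * γ (2 * n) =
        Complex.I * (Real.sqrt (n : ℝ) : ℂ) * (if n = 0 then 0 else γ (2 * n - 1))
          - Complex.I * (Real.sqrt ((n : ℝ) + a) : ℂ) * γ (2 * n + 1)) ∧
    ((p : ℂ) * γ (2 * n + 1) =
        Complex.I * (Real.sqrt ((n : ℝ) + a) : ℂ) * γ (2 * n)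
          - Complex.I * (Real.sqrt ((n : ℝ) + 1) : ℂ) * γ (2 * n + 2)) := by
  have hE : ∀ m, γ (2 * m) = (-1) ^ m * betaEv a p m := fun m => by
    rw [hγ, betaFn_two_mul, pow_mul, Complex.I_sq]
  have hO : ∀ m, γ (2 * m + 1) = (-1) ^ m * Complex.I * betaOdd a p m := fun m => by
    rw [hγ, betaFn_two_mul_add_one, pow_succ, pow_mul, Complex.I_sq]
  constructor
  · cases n with
    | zero =>
      have h := mul_betaEv_zero ha p
      rw [hE, hO]
      simp only [pow_zero, if_true, Nat.cast_zero, zero_add]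
      linear_combination h + √a * betaOdd a p 0 * Complex.I_sq
    | succ m =>
      have h := mul_betaEv_succ ha p m
      have e : 2 * (m + 1) - 1 = 2 * m + 1 := by omega
      rw [if_neg m.succ_ne_zero, e, hE, hO, hO]
      push_cast
      rw [pow_succ]
      linear_combination -(-1) ^ m * h - (-1) ^ m * (√((m : ℝ) + 1) * betaOdd a p m +
        √((m : ℝ) + 1 + a) * betaOdd a p (m + 1)) * Complex.I_sq
  · have h := mul_betaOdd_eq ha p n
    have e : 2 * n + 2 = 2 * (n + 1) := by ring
    rw [e, hO, hE, hE, pow_succ]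
    linear_combination (-1) ^ n * Complex.I * h
end
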